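/- arXiv:2307.04222 — 2 statements merged into one kernel-verified Lean document; each statement's English description precedes it below -/
import Mathlib

section
/- Let V be a finite set, let Q be a probability mass function on V, and let P be a probability mass function on V with supp(P) ⊆ supp(Q) that is decomposed as P = P₁ + P₂ where P₁ and P₂ are nonnegative functions on V. Then D(P ‖ Q) ≤ H₂( Σ_{v} P₂(v) ) + D(P₁ ‖ Q) + D(P₂ ‖ Q), where for a nonnegative function F with supp(F) ⊆ supp(Q) the (extended) relative entropy is D(F ‖ Q) = Σ_{v ∈ supp(F)} F(v) log₂(F(v)/Q(v)), and H₂ is the binary entropy function. -/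
open Finset
open scoped Classical

/-- Binary entropy function (base-2 logarithms). -/
noncomputable def H2 (x : ℝ) : ℝ := -(x * Real.logb 2 x) - (1 - x) * Real.logb 2 (1 - x)

/-- Base-2 relative entropy, extended in the natural way to nonnegative functions
(terms with `F v = 0` vanish). -/
noncomputable def relEnt {V : Type*} [Fintype V] (F Q : V → ℝ) : ℝ :=
  ∑ v, F v * Real.logb 2 (F v / Q v)

/-- Tangent-line bound for the logarithm, weighted by `a` and written as a comparison of the
log-ratios `p / q` and `a / q`. -/
lemma mul_logb_div_le {a p q s : ℝ} (ha : 0 ≤ a) (hap : a ≤ p) (hq : p ≠ 0 → q ≠ 0)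
    (hs : 0 ≤ s) (has : a ≠ 0 → s ≠ 0) :
    a * Real.logb 2 (p / q) ≤
      a * Real.logb 2 (a / q) - a * Real.logb 2 s + (p * s - a) / Real.log 2 := by
  have hlog : 0 < Real.log 2 := Real.log_pos one_lt_two
  rcases ha.eq_or_lt with rfl | ha'
  · have : 0 ≤ p * s / Real.log 2 := by positivity
    simpa using this
  have hp : 0 < p := ha'.trans_le hap
  have hs' : 0 < s := hs.lt_of_ne' (has ha'.ne')
  have hq' : q ≠ 0 := hq hp.ne'
  have key : a * Real.log (p * s / a) ≤ p * s - a := by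
    have h := mul_le_mul_of_nonneg_left (Real.log_le_sub_one_of_pos (x := p * s / a)
      (by positivity)) ha
    rwa [mul_sub, mul_div_cancel₀ _ ha'.ne', mul_one] at h
  rw [Real.log_div (by positivity) ha'.ne', Real.log_mul hp.ne' hs'.ne'] at key
  simp only [Real.logb]
  rw [Real.log_div hp.ne' hq', Real.log_div ha'.ne' hq', ← mul_div_assoc, ← mul_div_assoc,
    ← mul_div_assoc, ← sub_div, ← add_div]
  gcongr
  linarith

lemma sum_mul_logb_div_le_relEnt {V : Type*} [Fintype V] {A P Q : V → ℝ}
    (hA : ∀ v, 0 ≤ A v) (hAP : ∀ v, A v ≤ P v) (hP : ∑ v, P v = 1)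
    (hsupp : ∀ v, P v ≠ 0 → Q v ≠ 0) :
    ∑ v, A v * Real.logb 2 (P v / Q v) ≤
      relEnt A Q - (∑ v, A v) * Real.logb 2 (∑ v, A v) := by
  have hne (v : V) (hv : A v ≠ 0) : ∑ w, A w ≠ 0 := fun h =>
    hv ((sum_eq_zero_iff_of_nonneg fun w _ => hA w).1 h v (mem_univ v))
  have h := sum_le_sum fun v (_ : v ∈ univ) =>
    mul_logb_div_le (hA v) (hAP v) (hsupp v) (sum_nonneg fun w _ => hA w) (hne v)
  rwa [sum_add_distrib, sum_sub_distrib, ← sum_mul, ← sum_div, sum_sub_distrib, ← sum_mul, hP,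
    one_mul, sub_self, zero_div, add_zero] at h

/-- Lemma 5 (Goldfeld–Cuff–Permuter): if the PMF `P` (absolutely continuous w.r.t. `Q`)
decomposes as `P = P₁ + P₂` with `P₁, P₂ ≥ 0`, then
`D(P‖Q) ≤ H₂(Σ_v P₂(v)) + D(P₁‖Q) + D(P₂‖Q)`. -/
theorem relEnt_le_of_decomposition
    {V : Type*} [Fintype V] (P P1 P2 Q : V → ℝ)
    (hQ0 : ∀ v, 0 ≤ Q v) (hQ1 : ∑ v, Q v = 1)
    (hP0 : ∀ v, 0 ≤ P v) (hP1 : ∑ v, P v = 1)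
    (hsupp : ∀ v, P v ≠ 0 → Q v ≠ 0)
    (hP10 : ∀ v, 0 ≤ P1 v) (hP20 : ∀ v, 0 ≤ P2 v)
    (hdecomp : ∀ v, P v = P1 v + P2 v) :
    relEnt P Q ≤ H2 (∑ v, P2 v) + relEnt P1 Q + relEnt P2 Q := by
  have h1 := sum_mul_logb_div_le_relEnt (A := P1) hP10
    (fun v => by linarith [hdecomp v, hP20 v]) hP1 hsupp
  have h2 := sum_mul_logb_div_le_relEnt (A := P2) hP20
    (fun v => by linarith [hdecomp v, hP10 v]) hP1 hsupp
  have hs : ∑ v, P1 v = 1 - ∑ v, P2 v := by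
    rw [← hP1, ← sum_sub_distrib]
    exact sum_congr rfl fun v _ => by linarith [hdecomp v]
  have hsplit : relEnt P Q = ∑ v, P1 v * Real.logb 2 (P v / Q v) +
      ∑ v, P2 v * Real.logb 2 (P v / Q v) := by
    rw [relEnt, ← sum_add_distrib]
    exact sum_congr rfl fun v _ => by rw [← add_mul, ← hdecomp v]
  rw [hs] at h1
  rw [hsplit, H2]
  linarith
end

section
/- Let V be a finite set, let Q_V be a probability mass function on V, let n be a positive integer, and let P be a probability mass function on V^n with supp(P) ⊆ supp(Q_V^n), decomposed as P = P₁ + P₂ with P₁, P₂ nonnegative functions on V^n with supports contained in supp(Q_V^n). Let π₁ > 0 and suppose: (i) Σ_{v ∈ V^n} P₂(v) < 2^{−π₁ n}, and (ii) P₁(v)/Q_V^n(v) < 1 + 2^{−π₁ n} for all v ∈ supp(Q_V^n). Then D(P ‖ Q_V^n) < q_n · 2^{−π₁ n}, where q_n = 2 log₂ e + π₁ n + n log₂( max_{v ∈ supp(Q_V)} 1/Q_V(v) ), the relative entropies of P₁ and P₂ with respect to Q_V^n are extended in the natural way to nonnegative functions, and Q_V^n denotes the n-fold product of Q_V. -/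
open Finset
open scoped Classical

/-- Splitting the mass `a + b` costs at most `a * ε + b * (1 + L)` when `a ≤ (1 + ε) q`
and `a + b ≤ 1` with `log (1 / q) ≤ L`. -/
lemma add_mul_log_add_div_le {a b q ε L : ℝ} (ha : 0 ≤ a) (hb : 0 ≤ b) (hq : 0 < q)
    (hab : a + b ≤ 1) (hratio : a / q ≤ 1 + ε) (hL : Real.log (1 / q) ≤ L) :
    (a + b) * Real.log ((a + b) / q) ≤ a * ε + b * (1 + L) := by
  have hfst : a * Real.log ((a + b) / q) ≤ a * ε + b := by
    rcases ha.eq_or_lt with rfl | ha'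
    · simpa using hb
    have hsplit : (a + b) / q = a / q * ((a + b) / a) := by field_simp
    have haq : Real.log (a / q) ≤ ε := by
      have := Real.log_le_sub_one_of_pos (div_pos ha' hq)
      linarith
    have hba : Real.log ((a + b) / a) ≤ b / a := by
      have := Real.log_le_sub_one_of_pos (x := (a + b) / a) (by positivity)
      have h : (a + b) / a - 1 = b / a := by field_simp; ring
      linarith
    rw [hsplit, Real.log_mul (by positivity) (by positivity)]
    calc a * (Real.log (a / q) + Real.log ((a + b) / a)) ≤ a * (ε + b / a) := by gcongr
      _ = a * ε + b := by field_simp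
  have hsnd : b * Real.log ((a + b) / q) ≤ b * L := by
    rcases hb.eq_or_lt with rfl | hb'
    · simp
    gcongr
    refine le_trans (Real.log_le_log (by positivity) ?_) hL
    gcongr
  linarith

/-- The log-likelihood of a product distribution is bounded by that of its least likely letter. -/
lemma log_one_div_prod_le {V ι : Type*} [Finite V] [Fintype ι] {q : V → ℝ} (hq : ∀ v, 0 ≤ q v)
    {x : ι → V} (hx : ∏ j, q (x j) ≠ 0) :
    Real.log (1 / ∏ j, q (x j)) ≤
      Fintype.card ι * Real.log (sSup ((fun v => 1 / q v) '' {v | q v ≠ 0})) := by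
  have hne : ∀ j, q (x j) ≠ 0 := fun j => Finset.prod_ne_zero_iff.mp hx j (mem_univ j)
  have hpos : ∀ j, 0 < 1 / q (x j) := fun j =>
    one_div_pos.mpr (lt_of_le_of_ne (hq _) (hne j).symm)
  have hprod : 1 / ∏ j, q (x j) = ∏ j, 1 / q (x j) := by simp
  rw [hprod, Real.log_prod fun j _ => (hpos j).ne']
  refine (Finset.sum_le_card_nsmul univ _ _ fun j _ => Real.log_le_log (hpos j) ?_).trans_eq
    (by rw [nsmul_eq_mul, card_univ])
  exact le_csSup (Set.toFinite _).bddAbove ⟨x j, hne j, rfl⟩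

/-- The largest reciprocal of a probability mass function is at least one. -/
lemma one_le_sSup_one_div {V : Type*} [Fintype V] {q : V → ℝ} (hq : ∀ v, 0 ≤ q v)
    (hsum : ∑ v, q v = 1) : 1 ≤ sSup ((fun v => 1 / q v) '' {v | q v ≠ 0}) := by
  obtain ⟨v, -, hv⟩ := Finset.exists_ne_zero_of_sum_ne_zero (hsum ▸ one_ne_zero)
  refine le_trans ?_ (le_csSup (Set.toFinite _).bddAbove ⟨v, hv, rfl⟩)
  exact one_le_one_div (lt_of_le_of_ne (hq v) (Ne.symm hv))
    (hsum ▸ single_le_sum (fun w _ => hq w) (mem_univ v))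

/-- Lemma 6 (sufficient condition for soft covering): if `P = P₁ + P₂` on `Vⁿ` with
`Σ P₂ < 2^{−π₁n}` and `P₁(v)/Q_V^n(v) < 1 + 2^{−π₁n}` on the support of `Q_V^n`, then
`D(P ‖ Q_V^n) < q_n · 2^{−π₁ n}` with
`q_n = 2log₂e + π₁n + n·log₂(max_{v ∈ supp Q_V} 1/Q_V(v))`. -/
theorem relEnt_small_of_typical_conditions
    {V : Type*} [Fintype V] (QV : V → ℝ)
    (hQV0 : ∀ v, 0 ≤ QV v) (hQV1 : ∑ v, QV v = 1)
    (n : ℕ) (hn : 0 < n)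
    (P P1 P2 : (Fin n → V) → ℝ)
    (hP0 : ∀ v, 0 ≤ P v) (hPsum : ∑ v, P v = 1)
    (hP10 : ∀ v, 0 ≤ P1 v) (hP20 : ∀ v, 0 ≤ P2 v)
    (hdecomp : ∀ v, P v = P1 v + P2 v)
    (hsuppP : ∀ v : Fin n → V, P v ≠ 0 → (∏ j, QV (v j)) ≠ 0)
    (hsuppP1 : ∀ v : Fin n → V, P1 v ≠ 0 → (∏ j, QV (v j)) ≠ 0)
    (hsuppP2 : ∀ v : Fin n → V, P2 v ≠ 0 → (∏ j, QV (v j)) ≠ 0)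
    (π₁ : ℝ) (hπ₁ : 0 < π₁)
    (hsum2 : ∑ v, P2 v < (2 : ℝ) ^ (-(π₁ * n)))
    (hratio : ∀ v : Fin n → V, (∏ j, QV (v j)) ≠ 0 →
      P1 v / (∏ j, QV (v j)) < 1 + (2 : ℝ) ^ (-(π₁ * n))) :
    relEnt P (fun v : Fin n → V => ∏ j, QV (v j)) <
      (2 * Real.logb 2 (Real.exp 1) + π₁ * n
        + n * Real.logb 2 (sSup ((fun v => 1 / QV v) '' {v | QV v ≠ 0})))
        * (2 : ℝ) ^ (-(π₁ * n)) := by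
  set ε : ℝ := (2 : ℝ) ^ (-(π₁ * n))
  set M : ℝ := sSup ((fun v => 1 / QV v) '' {v | QV v ≠ 0})
  have hε0 : 0 < ε := by positivity
  have hlog2 : 0 < Real.log 2 := Real.log_pos one_lt_two
  have hM : 0 ≤ Real.log M := Real.log_nonneg (one_le_sSup_one_div hQV0 hQV1)
  have hpoint : ∀ v, P v * Real.log (P v / ∏ j, QV (v j)) ≤
      P1 v * ε + P2 v * (1 + n * Real.log M) := by
    intro v
    by_cases hv : ∏ j, QV (v j) = 0
    · have h : P v = 0 := by_contra fun h => hsuppP v h hv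
      have := hP10 v
      have := hP20 v
      rw [h, zero_mul]
      positivity
    · have hle : P v ≤ 1 := hPsum ▸ single_le_sum (fun w _ => hP0 w) (mem_univ v)
      rw [hdecomp v] at hle ⊢
      refine add_mul_log_add_div_le (hP10 v) (hP20 v)
        (lt_of_le_of_ne (prod_nonneg fun j _ => hQV0 _) (Ne.symm hv)) hle
        (hratio v hv).le ?_
      simpa only [Fintype.card_fin] using log_one_div_prod_le hQV0 hv
  have hnat : ∑ v, P v * Real.log (P v / ∏ j, QV (v j)) < (2 + n * Real.log M) * ε := by
    have hsum1 : ∑ v, P1 v ≤ 1 :=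
      hPsum ▸ sum_le_sum fun v _ => by linarith [hdecomp v, hP20 v]
    calc ∑ v, P v * Real.log (P v / ∏ j, QV (v j))
        ≤ ∑ v, (P1 v * ε + P2 v * (1 + n * Real.log M)) := sum_le_sum fun v _ => hpoint v
      _ = (∑ v, P1 v) * ε + (∑ v, P2 v) * (1 + n * Real.log M) := by
        rw [sum_add_distrib, sum_mul, sum_mul]
      _ < 1 * ε + ε * (1 + n * Real.log M) :=
        add_lt_add_of_le_of_lt (by gcongr) (by gcongr)
      _ = (2 + n * Real.log M) * ε := by ring
  have hpi : 0 ≤ π₁ * n * ε := by positivity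
  calc relEnt P (fun v : Fin n → V => ∏ j, QV (v j))
      = (∑ v, P v * Real.log (P v / ∏ j, QV (v j))) / Real.log 2 := by
        simp only [relEnt, Real.logb, sum_div, mul_div_assoc]
    _ < (2 + n * Real.log M) * ε / Real.log 2 := by gcongr
    _ ≤ (2 + n * Real.log M) * ε / Real.log 2 + π₁ * n * ε := le_add_of_nonneg_right hpi
    _ = _ := by rw [Real.logb, Real.logb, Real.log_exp]; ring
end
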